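/- Let 𝒞 ⊆ (ℤ/2)^{2n} be a doubly-even self-dual code with respect to η which is not F₄-even, let χ := √2·1_{2n} ∈ Λ(𝒞) and δ := χ/2 = (1/√2)·1_{2n} ∉ Λ(𝒞), and set Λ₀ := {λ ∈ Λ(𝒞) : χ ⊙ λ ∈ 2ℤ}, Λ₁ := {λ ∈ Λ(𝒞) : χ ⊙ λ ∈ 2ℤ+1}; set Λ₂ := Λ₁ + δ and Λ₃ := Λ₀ + δ if n is even, and Λ₂ := Λ₀ + δ and Λ₃ := Λ₁ + δ if n is odd. Then for every τ in the upper half-plane: Θ_{Λ₂}(τ) = ½[W_𝒞({ψ̃⁺_{ab}(τ)}) − W_𝒞({ψ̃⁻_{ab}(τ)})] and Θ_{Λ₃}(τ) = ½[W_𝒞({ψ̃⁺_{ab}(τ)}) + W_𝒞({ψ̃⁻_{ab}(τ)})], where, with ã, b̃ ∈ {0,1} the lifts of a, b ∈ ℤ/2, ψ̃⁺_{ab}(τ) := Θ_{ã+b̃,2}(τ)Θ̄_{ã−b̃−2,2}(τ) + Θ_{ã+b̃−2,2}(τ)Θ̄_{ã−b̃,2}(τ) and ψ̃⁻_{ab}(τ)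 := ψ̃⁺_{ab}(τ+1). -/

import Mathlib

noncomputable section
open scoped BigOperators

/-- The Lorentzian inner product `x ⊙ y = Σᵢ (xᵢ y_{n+i} + x_{n+i} yᵢ)` on `ℝ^{2n}`,
with coordinates indexed by `Fin n ⊕ Fin n` (metric `η = [[0,Iₙ],[Iₙ,0]]`). -/
def lorR {n : ℕ} (x y : Fin n ⊕ Fin n → ℝ) : ℝ :=
  ∑ i : Fin n, (x (Sum.inl i) * y (Sum.inr i) + x (Sum.inr i) * y (Sum.inl i))

/-- The Lorentzian inner product on `(ℤ/p)^{2n}`. -/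
def lorZmod {n p : ℕ} (x y : Fin n ⊕ Fin n → ZMod p) : ZMod p :=
  ∑ i : Fin n, (x (Sum.inl i) * y (Sum.inr i) + x (Sum.inr i) * y (Sum.inl i))

/-- The componentwise lift of a codeword in `(ℤ/p)^{2n}` to `{0,…,p−1}^{2n} ⊆ ℝ^{2n}`. -/
def liftR {n p : ℕ} (c : Fin n ⊕ Fin n → ZMod p) : Fin n ⊕ Fin n → ℝ :=
  fun i => ((c i).val : ℝ)

/-- The Construction A lattice `Λ(𝒞) = {(c̃ + p·m)/√p : c ∈ 𝒞, m ∈ ℤ^{2n}} ⊆ ℝ^{2n}`. -/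
def constrA {n : ℕ} (p : ℕ) (C : Set (Fin n ⊕ Fin n → ZMod p)) : Set (Fin n ⊕ Fin n → ℝ) :=
  {x | ∃ c ∈ C, ∃ m : Fin n ⊕ Fin n → ℤ, x = fun i => (liftR c i + p * m i) / Real.sqrt p}

/-- The dual `L* = {x : x ⊙ l ∈ ℤ for all l ∈ L}` with respect to the Lorentzian
inner product. -/
def dualLor {n : ℕ} (L : Set (Fin n ⊕ Fin n → ℝ)) : Set (Fin n ⊕ Fin n → ℝ) :=
  {x | ∀ l ∈ L, ∃ k : ℤ, lorR x l = (k : ℝ)}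

/-- `q^x := e^{2πiτx}` for real `x`. -/
def qpow (τ : ℂ) (x : ℝ) : ℂ := Complex.exp (2 * Real.pi * Complex.I * τ * x)

/-- `q̄^x := e^{−2πi·conj(τ)·x}` for real `x`. -/
def qbarpow (τ : ℂ) (x : ℝ) : ℂ :=
  Complex.exp (-(2 * Real.pi * Complex.I) * (starRingEnd ℂ τ) * x)

/-- The theta function `Θ_S(τ) = Σ_{λ∈S} q^{|λ₁+λ₂|²/4} q̄^{|λ₁−λ₂|²/4}` of a subset
`S ⊆ ℝ^{2n}`, where `λ = (λ₁, λ₂)`. -/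
def thetaSet {n : ℕ} (S : Set (Fin n ⊕ Fin n → ℝ)) (τ : ℂ) : ℂ :=
  ∑' l : S,
    qpow τ ((∑ i : Fin n, (l.1 (Sum.inl i) + l.1 (Sum.inr i)) ^ 2) / 4) *
      qbarpow τ ((∑ i : Fin n, (l.1 (Sum.inl i) - l.1 (Sum.inr i)) ^ 2) / 4)

/-- The complete weight enumerator `W_𝒞({x_{ab}}) = Σ_{(α,β)∈𝒞} Πᵢ x_{αᵢβᵢ}` of a code
`𝒞 ⊆ (ℤ/p)^{2n}`, evaluated on a family of complex numbers `x`. -/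
def cwe {n p : ℕ} (C : Set (Fin n ⊕ Fin n → ZMod p)) (x : ZMod p → ZMod p → ℂ) : ℂ :=
  ∑' c : C, ∏ i : Fin n, x (c.1 (Sum.inl i)) (c.1 (Sum.inr i))

/-- The theta function `Θ_{m,k}(τ) = Σ_{n∈ℤ} q^{k(n+m/(2k))²}`. -/
def thetaMK (m : ℤ) (k : ℕ) (τ : ℂ) : ℂ :=
  ∑' j : ℤ, qpow τ ((k : ℝ) * ((j : ℝ) + (m : ℝ) / (2 * (k : ℝ))) ^ 2)

/-- The conjugate theta function `Θ̄_{m,k}(τ) = Σ_{n∈ℤ} q̄^{k(n+m/(2k))²}`. -/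
def thetaMKbar (m : ℤ) (k : ℕ) (τ : ℂ) : ℂ :=
  ∑' j : ℤ, qbarpow τ ((k : ℝ) * ((j : ℝ) + (m : ℝ) / (2 * (k : ℝ))) ^ 2)

/-- `Λ₀ = {λ ∈ L : χ ⊙ λ ∈ 2ℤ}`. -/
def lam0 {n : ℕ} (L : Set (Fin n ⊕ Fin n → ℝ)) (χ : Fin n ⊕ Fin n → ℝ) :
    Set (Fin n ⊕ Fin n → ℝ) :=
  {l ∈ L | ∃ k : ℤ, lorR χ l = 2 * (k : ℝ)}

/-- `Λ₁ = {λ ∈ L : χ ⊙ λ ∈ 2ℤ+1}`. -/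
def lam1 {n : ℕ} (L : Set (Fin n ⊕ Fin n → ℝ)) (χ : Fin n ⊕ Fin n → ℝ) :
    Set (Fin n ⊕ Fin n → ℝ) :=
  {l ∈ L | ∃ k : ℤ, lorR χ l = 2 * (k : ℝ) + 1}

/-- The shift `S + v` of a subset `S ⊆ ℝ^{2n}` by the vector `v`. -/
def shiftSet {n : ℕ} (S : Set (Fin n ⊕ Fin n → ℝ)) (v : Fin n ⊕ Fin n → ℝ) :
    Set (Fin n ⊕ Fin n → ℝ) :=
  (· + v) '' S

/-- A binary code `𝒞 ⊆ (ℤ/2)^{2n}` is F₄-even if every codeword `c = (α, β)` satisfies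
`α̃·α̃ + β̃·β̃ − α̃·β̃ ∈ 2ℤ`, where `α̃, β̃ ∈ {0,1}^n` are the integer lifts. -/
def isF4Even {n : ℕ} (C : Set (Fin n ⊕ Fin n → ZMod 2)) : Prop :=
  ∀ c ∈ C, (2 : ℤ) ∣ ∑ i : Fin n,
    (((c (Sum.inl i)).val : ℤ) * ((c (Sum.inl i)).val : ℤ)
      + ((c (Sum.inr i)).val : ℤ) * ((c (Sum.inr i)).val : ℤ)
      - ((c (Sum.inl i)).val : ℤ) * ((c (Sum.inr i)).val : ℤ))

/-- A binary code `𝒞 ⊆ (ℤ/2)^{2n}` is doubly-even with respect to `η` if the integer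
lift of every codeword satisfies `c̃ ⊙ c̃ ∈ 4ℤ`. -/
def isDoublyEven {n : ℕ} (C : Set (Fin n ⊕ Fin n → ZMod 2)) : Prop :=
  ∀ c ∈ C, (4 : ℤ) ∣ ∑ i : Fin n,
    (((c (Sum.inl i)).val : ℤ) * ((c (Sum.inr i)).val : ℤ)
      + ((c (Sum.inr i)).val : ℤ) * ((c (Sum.inl i)).val : ℤ))

/-- `ψ̃⁺_{ab}(τ) = Θ_{ã+b̃,2}(τ)Θ̄_{ã−b̃−2,2}(τ) + Θ_{ã+b̃−2,2}(τ)Θ̄_{ã−b̃,2}(τ)`. -/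
def psiTP2' (a b : ZMod 2) (τ : ℂ) : ℂ :=
  thetaMK ((a.val : ℤ) + (b.val : ℤ)) 2 τ * thetaMKbar ((a.val : ℤ) - (b.val : ℤ) - 2) 2 τ
    + thetaMK ((a.val : ℤ) + (b.val : ℤ) - 2) 2 τ
        * thetaMKbar ((a.val : ℤ) - (b.val : ℤ)) 2 τ

/-- `ψ̃⁻_{ab}(τ) = ψ̃⁺_{ab}(τ+1)`. -/
def psiTM2' (a b : ZMod 2) (τ : ℂ) : ℂ := psiTP2' a b (τ + 1)

/-- A finite product of absolutely summable families is absolutely summable, and its sum is the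
product of the sums. -/
theorem summable_norm_and_tsum_prod_fin {R κ : Type*} [NormedCommRing R] [NormOneClass R]
    [CompleteSpace R] :
    ∀ {n : ℕ} (f : Fin n → κ → R), (∀ i, Summable fun k => ‖f i k‖) →
      (Summable fun m : Fin n → κ => ‖∏ i, f i (m i)‖) ∧
        ∑' m : Fin n → κ, ∏ i, f i (m i) = ∏ i, ∑' k, f i k
  | 0, f, _ => by
    refine ⟨(hasSum_fintype _).summable, ?_⟩
    rw [tsum_fintype]
    simp
  | n + 1, f, hf => by
    obtain ⟨hs, ht⟩ := summable_norm_and_tsum_prod_fin (fun i => f i.succ) fun i => hf i.succ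
    have hcons (p : κ × (Fin n → κ)) :
        ∏ i, f i (Fin.consEquiv (fun _ => κ) p i) = f 0 p.1 * ∏ i, f i.succ (p.2 i) := by
      simp [Fin.prod_univ_succ, Fin.consEquiv]
    constructor
    · rw [← (Fin.consEquiv fun _ => κ).summable_iff]
      simpa only [Function.comp_def, hcons] using (hf 0).mul_norm hs
    · rw [← (Fin.consEquiv fun _ => κ).tsum_eq]
      simp only [hcons]
      rw [← tsum_mul_tsum_of_summable_norm (hf 0) hs, ht, Fin.prod_univ_succ]

theorem qbarpow_eq_qpow (τ : ℂ) (x : ℝ) : qbarpow τ x = qpow (-starRingEnd ℂ τ) x := by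
  unfold qbarpow qpow
  congr 1
  ring

theorem thetaMKbar_eq_thetaMK (m : ℤ) (k : ℕ) (τ : ℂ) :
    thetaMKbar m k τ = thetaMK m k (-starRingEnd ℂ τ) := by
  simp only [thetaMKbar, thetaMK, qbarpow_eq_qpow]

theorem qpow_sum {ι : Type*} (s : Finset ι) (τ : ℂ) (x : ι → ℝ) :
    qpow τ (∑ i ∈ s, x i) = ∏ i ∈ s, qpow τ (x i) := by
  simp only [qpow, Complex.ofReal_sum, Finset.mul_sum, Complex.exp_sum]

theorem summable_qpow (m : ℤ) {τ : ℂ} (hτ : 0 < τ.im) :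
    Summable fun j : ℤ => qpow τ ((2 : ℕ) * ((j : ℝ) + (m : ℝ) / (2 * (2 : ℕ))) ^ 2) := by
  have h4 : 0 < (4 * τ).im := by simpa using hτ
  refine (((summable_jacobiTheta₂_term_iff (τ * m) (4 * τ)).2 h4).mul_left
    (Complex.exp (2 * Real.pi * Complex.I * τ * (m ^ 2 / 8)))).congr fun j => ?_
  rw [jacobiTheta₂_term, ← Complex.exp_add, qpow]
  congr 1
  push_cast
  ring

theorem thetaMK_two_add_one (m : ℤ) (τ : ℂ) :
    thetaMK m 2 (τ + 1) = Complex.exp (Real.pi * Complex.I * (m ^ 2 / 4)) * thetaMK m 2 τ := by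
  rw [thetaMK, thetaMK, ← tsum_mul_left]
  refine tsum_congr fun j => ?_
  rw [qpow, qpow, ← Complex.exp_add, Complex.exp_eq_exp_iff_exists_int]
  refine ⟨2 * j ^ 2 + j * m, ?_⟩
  push_cast
  ring

theorem thetaMKbar_two_add_one (m : ℤ) (τ : ℂ) :
    thetaMKbar m 2 (τ + 1) =
      Complex.exp (-(Real.pi * Complex.I * (m ^ 2 / 4))) * thetaMKbar m 2 τ := by
  have h := thetaMK_two_add_one m (-starRingEnd ℂ (τ + 1))
  rw [show -starRingEnd ℂ (τ + 1) + 1 = -starRingEnd ℂ τ by simp] at h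
  rw [thetaMKbar_eq_thetaMK, thetaMKbar_eq_thetaMK, h, ← mul_assoc, ← Complex.exp_add]
  simp

theorem thetaMK_mul_thetaMKbar_add_one (p r k : ℤ) (h : p ^ 2 - r ^ 2 = 4 * k) (τ : ℂ) :
    thetaMK p 2 (τ + 1) * thetaMKbar r 2 (τ + 1) =
      (-1) ^ k * (thetaMK p 2 τ * thetaMKbar r 2 τ) := by
  have hC : (p : ℂ) ^ 2 - (r : ℂ) ^ 2 = 4 * k := by exact_mod_cast h
  have hexp : Complex.exp (Real.pi * Complex.I * (p ^ 2 / 4)) *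
      Complex.exp (-(Real.pi * Complex.I * (r ^ 2 / 4))) = (-1) ^ k := by
    rw [← Complex.exp_pi_mul_I, ← Complex.exp_int_mul, ← Complex.exp_add]
    congr 1
    linear_combination (Real.pi * Complex.I / 4) * hC
  rw [thetaMK_two_add_one, thetaMKbar_two_add_one, ← hexp]
  ring

theorem psiTM2'_eq (a b : ZMod 2) (τ : ℂ) :
    psiTM2' a b τ = (-1) ^ (a.val * b.val + (a.val + b.val) + 1) * psiTP2' a b τ := by
  have hsign (k : ℤ) (l : ℕ) (h : Even (k - l)) : (-1 : ℂ) ^ k = (-1) ^ l := by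
    obtain ⟨t, ht⟩ := h
    rw [show k = l + 2 * t by omega, zpow_add₀ (by norm_num), zpow_mul]
    norm_num
  rw [psiTM2', psiTP2', psiTP2',
    thetaMK_mul_thetaMKbar_add_one _ _ (((a.val : ℤ) - 1) * (b.val + 1)) (by ring),
    thetaMK_mul_thetaMKbar_add_one _ _ (((a.val : ℤ) - 1) * (b.val - 1)) (by ring),
    hsign _ (a.val * b.val + (a.val + b.val) + 1) ⟨-b.val - 1, by push_cast; ring⟩,
    hsign _ (a.val * b.val + (a.val + b.val) + 1) ⟨-a.val - b.val, by push_cast; ring⟩,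
    ← mul_add]

/-- The contribution of the coordinate pair with residues `a, b` and integer shifts `u` to the
theta series of a shifted Construction A lattice. -/
def shiftedTerm (a b : ZMod 2) (τ : ℂ) (u : ℤ × ℤ) : ℂ :=
  qpow τ (((a.val : ℝ) + b.val + 2 * (u.1 + u.2) + 2) ^ 2 / 8) *
    qbarpow τ (((a.val : ℝ) - b.val + 2 * (u.1 - u.2)) ^ 2 / 8)

theorem hasSum_qpow_mul_qbarpow (p r : ℤ) {τ : ℂ} (hτ : 0 < τ.im) :
    HasSum (fun v : ℤ × ℤ => qpow τ ((p + 4 * v.1 : ℝ) ^ 2 / 8) *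
      qbarpow τ ((r + 4 * v.2 : ℝ) ^ 2 / 8)) (thetaMK p 2 τ * thetaMKbar r 2 τ) := by
  have hτ' : 0 < (-starRingEnd ℂ τ).im := by simpa using hτ
  have hp := (summable_qpow p hτ).norm
  have hr := (summable_qpow r hτ').norm
  have hx (m j : ℤ) :
      ((2 : ℕ) : ℝ) * (j + m / (2 * (2 : ℕ))) ^ 2 = (m + 4 * j : ℝ) ^ 2 / 8 := by
    push_cast
    ring
  rw [thetaMKbar_eq_thetaMK, thetaMK, thetaMK, tsum_mul_tsum_of_summable_norm hp hr]
  simp only [hx, qbarpow_eq_qpow] at hp hr ⊢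
  exact (summable_mul_of_summable_norm hp hr).hasSum

theorem hasSum_shiftedTerm (a b : ZMod 2) {τ : ℂ} (hτ : 0 < τ.im) :
    HasSum (shiftedTerm a b τ) (psiTP2' a b τ) := by
  let e₁ : ℤ × ℤ → ℤ × ℤ := fun v => (v.1 + v.2 - 1, v.1 - v.2)
  let e₂ : ℤ × ℤ → ℤ × ℤ := fun v => (v.1 + v.2 - 1, v.1 - v.2 - 1)
  have he₁ : Function.Injective e₁ := by
    rintro ⟨x, y⟩ ⟨z, w⟩ h
    simp only [e₁, Prod.mk.injEq] at h ⊢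
    omega
  have he₂ : Function.Injective e₂ := by
    rintro ⟨x, y⟩ ⟨z, w⟩ h
    simp only [e₂, Prod.mk.injEq] at h ⊢
    omega
  have hcompl : IsCompl (Set.range e₁) (Set.range e₂) := by
    constructor
    · rw [Set.disjoint_left]
      rintro _ ⟨⟨x, y⟩, rfl⟩ ⟨⟨z, w⟩, h⟩
      simp only [e₁, e₂, Prod.mk.injEq] at h
      omega
    · refine codisjoint_iff_le_sup.2 ?_
      rintro ⟨x, y⟩ -
      rcases Int.even_or_odd' (x + y) with ⟨k, hk | hk⟩
      · exact Or.inr ⟨(k + 1, x - k), by simp only [e₂, Prod.mk.injEq]; omega⟩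
      · exact Or.inl ⟨(k + 1, x - k), by simp only [e₁, Prod.mk.injEq]; omega⟩
  refine HasSum.add_isCompl hcompl (he₁.hasSum_range_iff.2 ?_) (he₂.hasSum_range_iff.2 ?_)
  · convert hasSum_qpow_mul_qbarpow (a.val + b.val) (a.val - b.val - 2) hτ using 1
    funext v
    simp only [e₁, shiftedTerm, Function.comp_apply]
    congr 3 <;> push_cast <;> ring
  · convert hasSum_qpow_mul_qbarpow (a.val + b.val - 2) (a.val - b.val) hτ using 1
    funext v
    simp only [e₂, shiftedTerm, Function.comp_apply]
    congr 3 <;> push_cast <;> ring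

/-- The point `(c̃ + 2m + 1) / √2` of the shifted Construction A lattice. -/
def shiftedPoint {n : ℕ} (c : Fin n ⊕ Fin n → ZMod 2) (m : Fin n → ℤ × ℤ) :
    Fin n ⊕ Fin n → ℝ :=
  Sum.elim (fun i => ((c (Sum.inl i)).val + 2 * (m i).1 + 1) / Real.sqrt 2)
    fun i => ((c (Sum.inr i)).val + 2 * (m i).2 + 1) / Real.sqrt 2

theorem shiftedPoint_injective {n : ℕ} :
    Function.Injective fun p : (Fin n ⊕ Fin n → ZMod 2) × (Fin n → ℤ × ℤ) =>
      shiftedPoint p.1 p.2 := by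
  have key (a b : ZMod 2) (k l : ℤ)
      (h : ((a.val : ℝ) + 2 * k + 1) / Real.sqrt 2 = ((b.val : ℝ) + 2 * l + 1) / Real.sqrt 2) :
      a = b ∧ k = l := by
    rw [div_left_inj' (by positivity)] at h
    have h' : (a.val : ℤ) + 2 * k + 1 = b.val + 2 * l + 1 := by exact_mod_cast h
    have ha := a.val_lt
    have hb := b.val_lt
    exact ⟨ZMod.val_injective 2 (by omega), by omega⟩
  rintro ⟨c, m⟩ ⟨c', m'⟩ h
  have hl (i : Fin n) := key _ _ _ _ (congrFun h (Sum.inl i))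
  have hr (i : Fin n) := key _ _ _ _ (congrFun h (Sum.inr i))
  refine Prod.ext (funext ?_) (funext fun i => Prod.ext (hl i).2 (hr i).2)
  rintro (i | i)
  · exact (hl i).1
  · exact (hr i).1

theorem shiftSet_constrA_eq_range {n : ℕ} (D : Set (Fin n ⊕ Fin n → ZMod 2)) :
    shiftSet (constrA 2 D) ((2 : ℝ)⁻¹ • fun _ => Real.sqrt 2) =
      Set.range fun p : D × (Fin n → ℤ × ℤ) => shiftedPoint p.1.1 p.2 := by
  have hs : Real.sqrt 2 * Real.sqrt 2 = 2 := Real.mul_self_sqrt (by norm_num)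
  have key (x y : ℝ) : (x + 2 * y) / Real.sqrt 2 + 2⁻¹ * Real.sqrt 2 =
      (x + 2 * y + 1) / Real.sqrt 2 := by
    field_simp
    linarith
  have hpoint (c : Fin n ⊕ Fin n → ZMod 2) (m : Fin n ⊕ Fin n → ℤ) :
      (fun i => (liftR c i + (2 : ℕ) * m i) / Real.sqrt (2 : ℕ)) +
        ((2 : ℝ)⁻¹ • fun _ => Real.sqrt 2) =
      shiftedPoint c fun i => (m (Sum.inl i), m (Sum.inr i)) := by
    funext i
    rcases i with i | i <;> simp [shiftedPoint, liftR, key]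
  ext x
  constructor
  · rintro ⟨_, ⟨c, hc, m, rfl⟩, rfl⟩
    exact ⟨(⟨c, hc⟩, fun i => (m (Sum.inl i), m (Sum.inr i))), (hpoint c m).symm⟩
  · rintro ⟨⟨⟨c, hc⟩, m⟩, rfl⟩
    exact ⟨_, ⟨c, hc, Sum.elim (fun i => (m i).1) fun i => (m i).2, rfl⟩, hpoint _ _⟩

theorem thetaSet_summand_shiftedPoint {n : ℕ} (c : Fin n ⊕ Fin n → ZMod 2)
    (m : Fin n → ℤ × ℤ) (τ : ℂ) :
    qpow τ ((∑ i : Fin n, (shiftedPoint c m (Sum.inl i) + shiftedPoint c m (Sum.inr i)) ^ 2) / 4) *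
      qbarpow τ
        ((∑ i : Fin n, (shiftedPoint c m (Sum.inl i) - shiftedPoint c m (Sum.inr i)) ^ 2) / 4) =
      ∏ i : Fin n, shiftedTerm (c (Sum.inl i)) (c (Sum.inr i)) τ (m i) := by
  have hs : Real.sqrt 2 ^ 2 = 2 := Real.sq_sqrt (by norm_num)
  simp only [shiftedTerm, Finset.prod_mul_distrib, qbarpow_eq_qpow, ← qpow_sum, Finset.sum_div]
  congr 2 <;> refine Finset.sum_congr rfl fun i _ => ?_
  · simp only [shiftedPoint, Sum.elim_inl, Sum.elim_inr, ← add_div, div_pow, hs]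
    ring
  · simp only [shiftedPoint, Sum.elim_inl, Sum.elim_inr, ← sub_div, div_pow, hs]
    ring

/-- The theta function of the shifted Construction A lattice of any binary code is its complete
weight enumerator evaluated at `ψ̃⁺`. -/
theorem thetaSet_shiftSet_constrA {n : ℕ} (D : Set (Fin n ⊕ Fin n → ZMod 2)) {τ : ℂ}
    (hτ : 0 < τ.im) :
    thetaSet (shiftSet (constrA 2 D) ((2 : ℝ)⁻¹ • fun _ => Real.sqrt 2)) τ =
      cwe D fun a b => psiTP2' a b τ := by
  have := Fintype.ofFinite D
  have hinj : Function.Injective fun p : D × (Fin n → ℤ × ℤ) => shiftedPoint p.1.1 p.2 := by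
    rintro ⟨c, m⟩ ⟨c', m'⟩ h
    have h' := @shiftedPoint_injective n (c.1, m) (c'.1, m') h
    simpa [Subtype.ext_iff] using h'
  have hfib (c : D) := summable_norm_and_tsum_prod_fin
    (fun i : Fin n => shiftedTerm (c.1 (Sum.inl i)) (c.1 (Sum.inr i)) τ)
    fun i => (hasSum_shiftedTerm _ _ hτ).summable.norm
  have hsum : Summable fun p : D × (Fin n → ℤ × ℤ) =>
      ∏ i, shiftedTerm (p.1.1 (Sum.inl i)) (p.1.1 (Sum.inr i)) τ (p.2 i) := by
    refine Summable.of_norm ((summable_prod_of_nonneg fun _ => norm_nonneg _).2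
      ⟨fun c => (hfib c).1, (hasSum_fintype _).summable⟩)
  rw [shiftSet_constrA_eq_range, thetaSet, tsum_range (f := fun x : Fin n ⊕ Fin n → ℝ =>
    qpow τ ((∑ i : Fin n, (x (Sum.inl i) + x (Sum.inr i)) ^ 2) / 4) *
      qbarpow τ ((∑ i : Fin n, (x (Sum.inl i) - x (Sum.inr i)) ^ 2) / 4)) hinj]
  simp only [thetaSet_summand_shiftedPoint]
  rw [hsum.tsum_prod' fun c => (hfib c).1.of_norm, cwe]
  refine tsum_congr fun c => ?_
  rw [(hfib c).2]
  exact Finset.prod_congr rfl fun i _ => (hasSum_shiftedTerm _ _ hτ).tsum_eq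

/-- The Hamming weight of a binary vector, as the sum of the lifts of its entries. -/
def liftWeight {n : ℕ} (c : Fin n ⊕ Fin n → ZMod 2) : ℕ :=
  ∑ i : Fin n, ((c (Sum.inl i)).val + (c (Sum.inr i)).val)

theorem lorR_sqrt_two_constrA {n : ℕ} (c : Fin n ⊕ Fin n → ZMod 2) (m : Fin n ⊕ Fin n → ℤ) :
    lorR (fun _ => Real.sqrt 2) (fun i => (liftR c i + (2 : ℕ) * m i) / Real.sqrt (2 : ℕ)) =
      ((liftWeight c + 2 * ∑ i : Fin n, (m (Sum.inl i) + m (Sum.inr i)) : ℤ) : ℝ) := by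
  have hpos : Real.sqrt 2 ≠ 0 := by positivity
  simp only [lorR, liftWeight, liftR]
  push_cast
  rw [Finset.mul_sum, ← Finset.sum_add_distrib]
  refine Finset.sum_congr rfl fun i _ => ?_
  field_simp
  ring

theorem lam0_constrA {n : ℕ} (C : Set (Fin n ⊕ Fin n → ZMod 2)) :
    lam0 (constrA 2 C) (fun _ => Real.sqrt 2) = constrA 2 {c ∈ C | Even (liftWeight c)} := by
  ext x
  constructor
  · rintro ⟨⟨c, hc, m, rfl⟩, k, hk⟩
    rw [lorR_sqrt_two_constrA] at hk
    have hk' : (liftWeight c + 2 * ∑ i : Fin n, (m (Sum.inl i) + m (Sum.inr i)) : ℤ) = 2 * k := by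
      exact_mod_cast hk
    exact ⟨c, ⟨hc, by rw [Nat.even_iff]; omega⟩, m, rfl⟩
  · rintro ⟨c, ⟨hc, k, hk⟩, m, rfl⟩
    refine ⟨⟨c, hc, m, rfl⟩, k + ∑ i : Fin n, (m (Sum.inl i) + m (Sum.inr i)), ?_⟩
    rw [lorR_sqrt_two_constrA, hk]
    push_cast
    ring

theorem lam1_constrA {n : ℕ} (C : Set (Fin n ⊕ Fin n → ZMod 2)) :
    lam1 (constrA 2 C) (fun _ => Real.sqrt 2) = constrA 2 {c ∈ C | ¬ Even (liftWeight c)} := by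
  ext x
  constructor
  · rintro ⟨⟨c, hc, m, rfl⟩, k, hk⟩
    rw [lorR_sqrt_two_constrA] at hk
    have hk' : (liftWeight c + 2 * ∑ i : Fin n, (m (Sum.inl i) + m (Sum.inr i)) : ℤ) =
        2 * k + 1 := by
      exact_mod_cast hk
    exact ⟨c, ⟨hc, by rw [Nat.even_iff]; omega⟩, m, rfl⟩
  · rintro ⟨c, ⟨hc, hk⟩, m, rfl⟩
    obtain ⟨k, hk⟩ := Nat.not_even_iff_odd.1 hk
    refine ⟨⟨c, hc, m, rfl⟩, k + ∑ i : Fin n, (m (Sum.inl i) + m (Sum.inr i)), ?_⟩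
    rw [lorR_sqrt_two_constrA, hk]
    push_cast
    ring

theorem prod_psiTM2'_eq {n : ℕ} {C : Set (Fin n ⊕ Fin n → ZMod 2)} (hde : isDoublyEven C)
    {c : Fin n ⊕ Fin n → ZMod 2} (hc : c ∈ C) (τ : ℂ) :
    ∏ i : Fin n, psiTM2' (c (Sum.inl i)) (c (Sum.inr i)) τ =
      (-1) ^ (liftWeight c + n) * ∏ i : Fin n, psiTP2' (c (Sum.inl i)) (c (Sum.inr i)) τ := by
  have heven : Even (∑ i : Fin n, (c (Sum.inl i)).val * (c (Sum.inr i)).val) := by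
    obtain ⟨k, hk⟩ := hde c hc
    have h2 : (2 : ℤ) * (∑ i : Fin n, (c (Sum.inl i)).val * (c (Sum.inr i)).val : ℕ) = 4 * k := by
      rw [← hk]
      push_cast
      rw [Finset.mul_sum]
      exact Finset.sum_congr rfl fun i _ => by ring
    rw [Nat.even_iff]
    omega
  simp only [psiTM2'_eq, Finset.prod_mul_distrib, Finset.prod_pow_eq_pow_sum,
    Finset.sum_add_distrib, liftWeight]
  simp [add_assoc, pow_add, heven.neg_one_pow]

theorem cwe_sep_eq {n : ℕ} {C : Set (Fin n ⊕ Fin n → ZMod 2)} (hde : isDoublyEven C) (τ : ℂ)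
    (P : (Fin n ⊕ Fin n → ZMod 2) → Prop) (s : ℂ)
    (hP : ∀ c, P c → s * (-1) ^ (liftWeight c + n) = 1)
    (hnP : ∀ c, ¬ P c → s * (-1) ^ (liftWeight c + n) = -1) :
    cwe {c ∈ C | P c} (fun a b => psiTP2' a b τ) =
      (cwe C (fun a b => psiTP2' a b τ) + s * cwe C (fun a b => psiTM2' a b τ)) / 2 := by
  classical
  simp only [cwe]
  rw [tsum_subtype {c ∈ C | P c} fun c : Fin n ⊕ Fin n → ZMod 2 =>
      ∏ i : Fin n, psiTP2' (c (Sum.inl i)) (c (Sum.inr i)) τ,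
    tsum_subtype C fun c : Fin n ⊕ Fin n → ZMod 2 =>
      ∏ i : Fin n, psiTP2' (c (Sum.inl i)) (c (Sum.inr i)) τ,
    tsum_subtype C fun c : Fin n ⊕ Fin n → ZMod 2 =>
      ∏ i : Fin n, psiTM2' (c (Sum.inl i)) (c (Sum.inr i)) τ,
    tsum_fintype, tsum_fintype, tsum_fintype, Finset.mul_sum, ← Finset.sum_add_distrib,
    Finset.sum_div]
  refine Finset.sum_congr rfl fun c _ => ?_
  by_cases hc : c ∈ C
  · by_cases h : P c
    · simp only [Set.indicator, Set.mem_ofPred_eq, hc, h, and_self, if_true, prod_psiTM2'_eq hde hc]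
      rw [← mul_assoc, hP c h]
      ring
    · simp only [Set.indicator, Set.mem_ofPred_eq, hc, h, and_false, if_true, if_false,
        prod_psiTM2'_eq hde hc]
      rw [← mul_assoc, hnP c h]
      ring
  · simp [Set.indicator, hc]

/-- Let `𝒞 ⊆ (ℤ/2)^{2n}` be a doubly-even self-dual code with respect to `η` which is
not F₄-even, `χ := √2·1_{2n} ∈ Λ(𝒞)`, `δ := χ/2 = (1/√2)·1_{2n} ∉ Λ(𝒞)`, and `Λ₀, Λ₁`
the `Z₂`-graded parts of `Λ(𝒞)`; set `Λ₂ := Λ₁ + δ`, `Λ₃ := Λ₀ + δ` if `n` is even, and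
`Λ₂ := Λ₀ + δ`, `Λ₃ := Λ₁ + δ` if `n` is odd. Then for every `τ` in the upper
half-plane, `Θ_{Λ₂}(τ) = ½[W_𝒞({ψ̃⁺(τ)}) − W_𝒞({ψ̃⁻(τ)})]` and
`Θ_{Λ₃}(τ) = ½[W_𝒞({ψ̃⁺(τ)}) + W_𝒞({ψ̃⁻(τ)})]`. -/
theorem statement19 {n : ℕ} (hn : 1 ≤ n)
    (C : Submodule (ZMod 2) (Fin n ⊕ Fin n → ZMod 2))
    (hde : isDoublyEven (C : Set (Fin n ⊕ Fin n → ZMod 2)))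
    (hsd : (C : Set (Fin n ⊕ Fin n → ZMod 2)) = {v | ∀ c ∈ C, lorZmod v c = 0})
    (hnf4 : ¬ isF4Even (C : Set (Fin n ⊕ Fin n → ZMod 2)))
    (χ δ : Fin n ⊕ Fin n → ℝ)
    (hχ : χ = fun _ => Real.sqrt 2) (hδ : δ = (2 : ℝ)⁻¹ • χ)
    (Λ₂ Λ₃ : Set (Fin n ⊕ Fin n → ℝ))
    (hcaseEven : n % 2 = 0 →
      Λ₂ = shiftSet (lam1 (constrA 2 (C : Set (Fin n ⊕ Fin n → ZMod 2))) χ) δ ∧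
      Λ₃ = shiftSet (lam0 (constrA 2 (C : Set (Fin n ⊕ Fin n → ZMod 2))) χ) δ)
    (hcaseOdd : n % 2 = 1 →
      Λ₂ = shiftSet (lam0 (constrA 2 (C : Set (Fin n ⊕ Fin n → ZMod 2))) χ) δ ∧
      Λ₃ = shiftSet (lam1 (constrA 2 (C : Set (Fin n ⊕ Fin n → ZMod 2))) χ) δ)
    (τ : ℂ) (hτ : 0 < τ.im) :
    thetaSet Λ₂ τ =
        (cwe (C : Set (Fin n ⊕ Fin n → ZMod 2)) (fun a b => psiTP2' a b τ)
          - cwe (C : Set (Fin n ⊕ Fin n → ZMod 2)) (fun a b => psiTM2' a b τ)) / 2 ∧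
      thetaSet Λ₃ τ =
        (cwe (C : Set (Fin n ⊕ Fin n → ZMod 2)) (fun a b => psiTP2' a b τ)
          + cwe (C : Set (Fin n ⊕ Fin n → ZMod 2)) (fun a b => psiTM2' a b τ)) / 2 := by
  subst hδ hχ
  have hpow {k : ℕ} : (-1 : ℂ) ^ k = if Even k then 1 else -1 := by
    split_ifs with h
    · exact h.neg_one_pow
    · exact (Nat.not_even_iff_odd.1 h).neg_one_pow
  rcases Nat.mod_two_eq_zero_or_one n with h | h
  · obtain ⟨rfl, rfl⟩ := hcaseEven h
    have hn2 : Even n := Nat.even_iff.2 h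
    rw [lam0_constrA, lam1_constrA, thetaSet_shiftSet_constrA _ hτ, thetaSet_shiftSet_constrA _ hτ,
      cwe_sep_eq hde τ _ (-1), cwe_sep_eq hde τ _ 1]
    · exact ⟨by ring, by ring⟩
    all_goals intro c hc; simp [hpow, Nat.even_add, hn2, hc]
  · obtain ⟨rfl, rfl⟩ := hcaseOdd h
    have hn2 : ¬ Even n := by rw [Nat.even_iff]; omega
    rw [lam0_constrA, lam1_constrA, thetaSet_shiftSet_constrA _ hτ, thetaSet_shiftSet_constrA _ hτ,
      cwe_sep_eq hde τ _ (-1), cwe_sep_eq hde τ _ 1]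
    · exact ⟨by ring, by ring⟩
    all_goals intro c hc; simp [hpow, Nat.even_add, hn2, hc]
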